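/- arXiv:0708.2054 — 2 statements merged into one kernel-verified Lean document; each statement's English description precedes it below -/
import Mathlib

section
/- Let F be a field of characteristic zero, let x_1, x_2, x_3, x_4 be pairwise distinct elements of F, let a_1, …, a_5 ∈ F, and set f(s) = 1 + a_1 s + a_2 s² + a_3 s³ + a_4 s⁴ + a_5 s⁵. Let P = {(1,3),(1,4),(2,3),(2,4),(3,4)}. Then the coefficient of t⁵ in the polynomial (1/2) Σ_{σ ∈ S_4} Π_{(i,j) ∈ P} f(t(x_{σ(i)} − x_{σ(j)})) / (x_{σ(i)} − x_{σ(j)}) ∈ F[t] equals 4(3a_1⁵ + 12a_1³a_2 + 7a_1a_2² − 5a_1²a_3 − 2a_2a_3 − 10a_1a_4 + 5a_5). (This computes the cobordism class of M¹⁰ = SU(4)/S(U(1)×U(1)×U(2)) with the invariant complex structure J_1, whose weights at the identity fixed point are x_1−x_3, x_1−x_4, x_2−x_3, x_2−x_4, x_3−x_4; the sum over the 12 fixed points equals half the sum over all σ ∈ S_4 since each summand is invariant under the Weyl group of H.) -/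
open Polynomial

/-- A sum over the permutations of `Fin 4`, written out in terms of signs and values. -/
theorem sum_perm_fin_four {M : Type*} [AddCommMonoid M]
    (g : ℤ → Fin 4 → Fin 4 → Fin 4 → Fin 4 → M) :
    ∑ σ : Equiv.Perm (Fin 4), g (Equiv.Perm.sign σ : ℤ) (σ 0) (σ 1) (σ 2) (σ 3) =
      g 1 0 1 2 3 +
      g (-1) 0 1 3 2 +
      g (-1) 0 2 1 3 +
      g 1 0 2 3 1 +
      g 1 0 3 1 2 +
      g (-1) 0 3 2 1 +
      g (-1) 1 0 2 3 +
      g 1 1 0 3 2 +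
      g 1 1 2 0 3 +
      g (-1) 1 2 3 0 +
      g (-1) 1 3 0 2 +
      g 1 1 3 2 0 +
      g 1 2 0 1 3 +
      g (-1) 2 0 3 1 +
      g (-1) 2 1 0 3 +
      g 1 2 1 3 0 +
      g 1 2 3 0 1 +
      g (-1) 2 3 1 0 +
      g (-1) 3 0 1 2 +
      g 1 3 0 2 1 +
      g 1 3 1 0 2 +
      g (-1) 3 1 2 0 +
      g (-1) 3 2 0 1 +
      g 1 3 2 1 0 := by
  have h : (Finset.univ : Finset (Equiv.Perm (Fin 4))).val.map
      (fun σ => ((Equiv.Perm.sign σ : ℤ), σ 0, σ 1, σ 2, σ 3)) =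
      (([(1, 0, 1, 2, 3),
      (-1, 0, 1, 3, 2),
      (-1, 0, 2, 1, 3),
      (1, 0, 2, 3, 1),
      (1, 0, 3, 1, 2),
      (-1, 0, 3, 2, 1),
      (-1, 1, 0, 2, 3),
      (1, 1, 0, 3, 2),
      (1, 1, 2, 0, 3),
      (-1, 1, 2, 3, 0),
      (-1, 1, 3, 0, 2),
      (1, 1, 3, 2, 0),
      (1, 2, 0, 1, 3),
      (-1, 2, 0, 3, 1),
      (-1, 2, 1, 0, 3),
      (1, 2, 1, 3, 0),
      (1, 2, 3, 0, 1),
      (-1, 2, 3, 1, 0),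
      (-1, 3, 0, 1, 2),
      (1, 3, 0, 2, 1),
      (1, 3, 1, 0, 2),
      (-1, 3, 1, 2, 0),
      (-1, 3, 2, 0, 1),
      (1, 3, 2, 1, 0)] : List (ℤ × Fin 4 × Fin 4 × Fin 4 × Fin 4)) :
        Multiset (ℤ × Fin 4 × Fin 4 × Fin 4 × Fin 4)) := by
    decide
  have h' := congrArg (fun m => (m.map fun z => g z.1 z.2.1 z.2.2.1 z.2.2.2.1 z.2.2.2.2).sum) h
  simp only [Multiset.map_map, Function.comp_def] at h'
  refine Eq.trans h' ?_
  simp [add_assoc]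

/-- The Vandermonde product of four elements. -/
def vandermondeFour {R : Type*} [CommRing R] (a b c d : R) : R :=
  (a - b) * (a - c) * (a - d) * (b - c) * (b - d) * (c - d)

theorem vandermondeFour_comp_perm {R : Type*} [CommRing R] (x : Fin 4 → R)
    (σ : Equiv.Perm (Fin 4)) :
    vandermondeFour (x (σ 0)) (x (σ 1)) (x (σ 2)) (x (σ 3)) =
      ((Equiv.Perm.sign σ : ℤ) : R) * vandermondeFour (x 0) (x 1) (x 2) (x 3) := by
  have key (y : Fin 4 → R) :
      vandermondeFour (y 0) (y 1) (y 2) (y 3) = (Matrix.vandermonde y).det := by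
    rw [Matrix.det_vandermonde]
    have h0 : Finset.Ioi (0 : Fin 4) = {1, 2, 3} := by decide
    have h1 : Finset.Ioi (1 : Fin 4) = {2, 3} := by decide
    have h2 : Finset.Ioi (2 : Fin 4) = {3} := by decide
    have h3 : Finset.Ioi (3 : Fin 4) = ∅ := by decide
    simp only [Fin.prod_univ_four, h0, h1, h2, h3]
    simp [vandermondeFour]
    ring
  rw [key x, ← Matrix.det_permute σ (Matrix.vandermonde x)]
  exact key (x ∘ σ)

/-- The monomial symmetric polynomial of the partition `1 + 1 + 1 + 1 + 1` in five variables. -/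
def msymmOneOneOneOneOne {R : Type*} [CommRing R] (p q r s t : R) : R :=
  p * q * r * s * t

/-- The monomial symmetric polynomial of the partition `2 + 1 + 1 + 1` in five variables. -/
def msymmTwoOneOneOne {R : Type*} [CommRing R] (p q r s t : R) : R :=
  p ^ 2 * q * r * s + p ^ 2 * q * r * t + p ^ 2 * q * s * t + p ^ 2 * r * s * t + p * q ^ 2 * r
  * s + p * q ^ 2 * r * t + p * q ^ 2 * s * t + p * q * r ^ 2 * s + p * q * r ^ 2 * t + p * q *
  r * s ^ 2 + p * q * r * t ^ 2 + p * q * s ^ 2 * t + p * q * s * t ^ 2 + p * r ^ 2 * s * t + p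
  * r * s ^ 2 * t + p * r * s * t ^ 2 + q ^ 2 * r * s * t + q * r ^ 2 * s * t + q * r * s ^ 2 *
  t + q * r * s * t ^ 2

/-- The monomial symmetric polynomial of the partition `2 + 2 + 1` in five variables. -/
def msymmTwoTwoOne {R : Type*} [CommRing R] (p q r s t : R) : R :=
  p ^ 2 * q ^ 2 * r + p ^ 2 * q ^ 2 * s + p ^ 2 * q ^ 2 * t + p ^ 2 * q * r ^ 2 + p ^ 2 * q * s
  ^ 2 + p ^ 2 * q * t ^ 2 + p ^ 2 * r ^ 2 * s + p ^ 2 * r ^ 2 * t + p ^ 2 * r * s ^ 2 + p ^ 2 *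
  r * t ^ 2 + p ^ 2 * s ^ 2 * t + p ^ 2 * s * t ^ 2 + p * q ^ 2 * r ^ 2 + p * q ^ 2 * s ^ 2 + p
  * q ^ 2 * t ^ 2 + p * r ^ 2 * s ^ 2 + p * r ^ 2 * t ^ 2 + p * s ^ 2 * t ^ 2 + q ^ 2 * r ^ 2 *
  s + q ^ 2 * r ^ 2 * t + q ^ 2 * r * s ^ 2 + q ^ 2 * r * t ^ 2 + q ^ 2 * s ^ 2 * t + q ^ 2 * s
  * t ^ 2 + q * r ^ 2 * s ^ 2 + q * r ^ 2 * t ^ 2 + q * s ^ 2 * t ^ 2 + r ^ 2 * s ^ 2 * t + r ^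
  2 * s * t ^ 2 + r * s ^ 2 * t ^ 2

/-- The monomial symmetric polynomial of the partition `3 + 1 + 1` in five variables. -/
def msymmThreeOneOne {R : Type*} [CommRing R] (p q r s t : R) : R :=
  p ^ 3 * q * r + p ^ 3 * q * s + p ^ 3 * q * t + p ^ 3 * r * s + p ^ 3 * r * t + p ^ 3 * s * t
  + p * q ^ 3 * r + p * q ^ 3 * s + p * q ^ 3 * t + p * q * r ^ 3 + p * q * s ^ 3 + p * q * t ^
  3 + p * r ^ 3 * s + p * r ^ 3 * t + p * r * s ^ 3 + p * r * t ^ 3 + p * s ^ 3 * t + p * s * t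
  ^ 3 + q ^ 3 * r * s + q ^ 3 * r * t + q ^ 3 * s * t + q * r ^ 3 * s + q * r ^ 3 * t + q * r *
  s ^ 3 + q * r * t ^ 3 + q * s ^ 3 * t + q * s * t ^ 3 + r ^ 3 * s * t + r * s ^ 3 * t + r * s
  * t ^ 3

/-- The monomial symmetric polynomial of the partition `3 + 2` in five variables. -/
def msymmThreeTwo {R : Type*} [CommRing R] (p q r s t : R) : R :=
  p ^ 3 * q ^ 2 + p ^ 3 * r ^ 2 + p ^ 3 * s ^ 2 + p ^ 3 * t ^ 2 + p ^ 2 * q ^ 3 + p ^ 2 * r ^ 3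
  + p ^ 2 * s ^ 3 + p ^ 2 * t ^ 3 + q ^ 3 * r ^ 2 + q ^ 3 * s ^ 2 + q ^ 3 * t ^ 2 + q ^ 2 * r ^
  3 + q ^ 2 * s ^ 3 + q ^ 2 * t ^ 3 + r ^ 3 * s ^ 2 + r ^ 3 * t ^ 2 + r ^ 2 * s ^ 3 + r ^ 2 * t
  ^ 3 + s ^ 3 * t ^ 2 + s ^ 2 * t ^ 3

/-- The monomial symmetric polynomial of the partition `4 + 1` in five variables. -/
def msymmFourOne {R : Type*} [CommRing R] (p q r s t : R) : R :=
  p ^ 4 * q + p ^ 4 * r + p ^ 4 * s + p ^ 4 * t + p * q ^ 4 + p * r ^ 4 + p * s ^ 4 + p * t ^ 4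
  + q ^ 4 * r + q ^ 4 * s + q ^ 4 * t + q * r ^ 4 + q * s ^ 4 + q * t ^ 4 + r ^ 4 * s + r ^ 4 *
  t + r * s ^ 4 + r * t ^ 4 + s ^ 4 * t + s * t ^ 4

/-- The monomial symmetric polynomial of the partition `5` in five variables. -/
def msymmFive {R : Type*} [CommRing R] (p q r s t : R) : R :=
  p ^ 5 + q ^ 5 + r ^ 5 + s ^ 5 + t ^ 5

theorem sum_sign_mul_msymmOneOneOneOneOne {R : Type*} [CommRing R] (x : Fin 4 → R) :
    ∑ σ : Equiv.Perm (Fin 4), ((Equiv.Perm.sign σ : ℤ) : R) * ((x (σ 0) - x (σ 1)) *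
      msymmOneOneOneOneOne (x (σ 0) - x (σ 2)) (x (σ 0) - x (σ 3)) (x (σ 1) - x (σ 2))
        (x (σ 1) - x (σ 3)) (x (σ 2) - x (σ 3))) =
      24 * vandermondeFour (x 0) (x 1) (x 2) (x 3) := by
  rw [sum_perm_fin_four fun ε i j k l => (ε : R) * ((x i - x j) *
    msymmOneOneOneOneOne (x i - x k) (x i - x l) (x j - x k) (x j - x l) (x k - x l))]
  simp only [msymmOneOneOneOneOne, vandermondeFour]
  push_cast
  ring

theorem sum_sign_mul_msymmTwoOneOneOne {R : Type*} [CommRing R] (x : Fin 4 → R) :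
    ∑ σ : Equiv.Perm (Fin 4), ((Equiv.Perm.sign σ : ℤ) : R) * ((x (σ 0) - x (σ 1)) *
      msymmTwoOneOneOne (x (σ 0) - x (σ 2)) (x (σ 0) - x (σ 3)) (x (σ 1) - x (σ 2))
        (x (σ 1) - x (σ 3)) (x (σ 2) - x (σ 3))) =
      96 * vandermondeFour (x 0) (x 1) (x 2) (x 3) := by
  rw [sum_perm_fin_four fun ε i j k l => (ε : R) * ((x i - x j) *
    msymmTwoOneOneOne (x i - x k) (x i - x l) (x j - x k) (x j - x l) (x k - x l))]
  simp only [msymmTwoOneOneOne, vandermondeFour]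
  push_cast
  ring

theorem sum_sign_mul_msymmTwoTwoOne {R : Type*} [CommRing R] (x : Fin 4 → R) :
    ∑ σ : Equiv.Perm (Fin 4), ((Equiv.Perm.sign σ : ℤ) : R) * ((x (σ 0) - x (σ 1)) *
      msymmTwoTwoOne (x (σ 0) - x (σ 2)) (x (σ 0) - x (σ 3)) (x (σ 1) - x (σ 2))
        (x (σ 1) - x (σ 3)) (x (σ 2) - x (σ 3))) =
      56 * vandermondeFour (x 0) (x 1) (x 2) (x 3) := by
  rw [sum_perm_fin_four fun ε i j k l => (ε : R) * ((x i - x j) *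
    msymmTwoTwoOne (x i - x k) (x i - x l) (x j - x k) (x j - x l) (x k - x l))]
  simp only [msymmTwoTwoOne, vandermondeFour]
  push_cast
  ring

theorem sum_sign_mul_msymmThreeOneOne {R : Type*} [CommRing R] (x : Fin 4 → R) :
    ∑ σ : Equiv.Perm (Fin 4), ((Equiv.Perm.sign σ : ℤ) : R) * ((x (σ 0) - x (σ 1)) *
      msymmThreeOneOne (x (σ 0) - x (σ 2)) (x (σ 0) - x (σ 3)) (x (σ 1) - x (σ 2))
        (x (σ 1) - x (σ 3)) (x (σ 2) - x (σ 3))) =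
      (-40) * vandermondeFour (x 0) (x 1) (x 2) (x 3) := by
  rw [sum_perm_fin_four fun ε i j k l => (ε : R) * ((x i - x j) *
    msymmThreeOneOne (x i - x k) (x i - x l) (x j - x k) (x j - x l) (x k - x l))]
  simp only [msymmThreeOneOne, vandermondeFour]
  push_cast
  ring

theorem sum_sign_mul_msymmThreeTwo {R : Type*} [CommRing R] (x : Fin 4 → R) :
    ∑ σ : Equiv.Perm (Fin 4), ((Equiv.Perm.sign σ : ℤ) : R) * ((x (σ 0) - x (σ 1)) *
      msymmThreeTwo (x (σ 0) - x (σ 2)) (x (σ 0) - x (σ 3)) (x (σ 1) - x (σ 2))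
        (x (σ 1) - x (σ 3)) (x (σ 2) - x (σ 3))) =
      (-16) * vandermondeFour (x 0) (x 1) (x 2) (x 3) := by
  rw [sum_perm_fin_four fun ε i j k l => (ε : R) * ((x i - x j) *
    msymmThreeTwo (x i - x k) (x i - x l) (x j - x k) (x j - x l) (x k - x l))]
  simp only [msymmThreeTwo, vandermondeFour]
  push_cast
  ring

theorem sum_sign_mul_msymmFourOne {R : Type*} [CommRing R] (x : Fin 4 → R) :
    ∑ σ : Equiv.Perm (Fin 4), ((Equiv.Perm.sign σ : ℤ) : R) * ((x (σ 0) - x (σ 1)) *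
      msymmFourOne (x (σ 0) - x (σ 2)) (x (σ 0) - x (σ 3)) (x (σ 1) - x (σ 2))
        (x (σ 1) - x (σ 3)) (x (σ 2) - x (σ 3))) =
      (-80) * vandermondeFour (x 0) (x 1) (x 2) (x 3) := by
  rw [sum_perm_fin_four fun ε i j k l => (ε : R) * ((x i - x j) *
    msymmFourOne (x i - x k) (x i - x l) (x j - x k) (x j - x l) (x k - x l))]
  simp only [msymmFourOne, vandermondeFour]
  push_cast
  ring

theorem sum_sign_mul_msymmFive {R : Type*} [CommRing R] (x : Fin 4 → R) :
    ∑ σ : Equiv.Perm (Fin 4), ((Equiv.Perm.sign σ : ℤ) : R) * ((x (σ 0) - x (σ 1)) *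
      msymmFive (x (σ 0) - x (σ 2)) (x (σ 0) - x (σ 3)) (x (σ 1) - x (σ 2))
        (x (σ 1) - x (σ 3)) (x (σ 2) - x (σ 3))) =
      40 * vandermondeFour (x 0) (x 1) (x 2) (x 3) := by
  rw [sum_perm_fin_four fun ε i j k l => (ε : R) * ((x i - x j) *
    msymmFive (x i - x k) (x i - x l) (x j - x k) (x j - x l) (x k - x l))]
  simp only [msymmFive, vandermondeFour]
  push_cast
  ring

theorem coeff_five_prod {R : Type*} [CommRing R] (a₁ a₂ a₃ a₄ a₅ : R) (f : R → R[X])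
    (hf : ∀ c : R, f c = 1 + C (a₁ * c) * X + C (a₂ * c ^ 2) * X ^ 2 +
      C (a₃ * c ^ 3) * X ^ 3 + C (a₄ * c ^ 4) * X ^ 4 + C (a₅ * c ^ 5) * X ^ 5)
    (p q r s t : R) :
    (f p * f q * f r * f s * f t).coeff 5 =
      a₁ ^ 5 * msymmOneOneOneOneOne p q r s t + a₁ ^ 3 * a₂ * msymmTwoOneOneOne p q r s t + a₁ *
      a₂ ^ 2 * msymmTwoTwoOne p q r s t + a₁ ^ 2 * a₃ * msymmThreeOneOne p q r s t + a₂ * a₃ *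
      msymmThreeTwo p q r s t + a₁ * a₄ * msymmFourOne p q r s t + a₅ * msymmFive p q r s t := by
  have h0 (c : R) : (f c).coeff 0 = 1 := by simp [hf]
  have h1 (c : R) : (f c).coeff 1 = a₁ * c := by
    simp [hf, coeff_one, coeff_X_pow, -map_mul, -map_pow]
  have h2 (c : R) : (f c).coeff 2 = a₂ * c ^ 2 := by
    simp [hf, coeff_one, coeff_X_pow, -map_mul, -map_pow]
  have h3 (c : R) : (f c).coeff 3 = a₃ * c ^ 3 := by
    simp [hf, coeff_one, coeff_X_pow, -map_mul, -map_pow]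
  have h4 (c : R) : (f c).coeff 4 = a₄ * c ^ 4 := by
    simp [hf, coeff_one, coeff_X_pow, -map_mul, -map_pow]
  have h5 (c : R) : (f c).coeff 5 = a₅ * c ^ 5 := by
    simp [hf, coeff_one, coeff_X_pow, -map_mul, -map_pow]
  simp only [coeff_mul, Finset.Nat.antidiagonal_succ, Finset.Nat.antidiagonal_zero,
    Finset.sum_cons, Finset.map_cons, Finset.map_singleton, Finset.sum_singleton,
    Function.Embedding.coe_prodMap, Function.Embedding.coeFn_mk,
    Function.Embedding.refl_apply, Prod.map_apply, Nat.succ_eq_add_one, Nat.reduceAdd,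
    h0, h1, h2, h3, h4, h5]
  simp only [msymmOneOneOneOneOne, msymmTwoOneOneOne, msymmTwoTwoOne, msymmThreeOneOne,
    msymmThreeTwo, msymmFourOne, msymmFive]
  ring

/-- Cobordism class of `M¹⁰ = SU(4)/S(U(1)×U(1)×U(2))` with the invariant
complex structure `J₁` (weights `x₁−x₃, x₁−x₄, x₂−x₃, x₂−x₄, x₃−x₄`): the coefficient of
`t⁵` in `(1/2) Σ_{σ ∈ S₄} Π_{(i,j)∈P} f(t(x_{σ(i)}−x_{σ(j)}))/(x_{σ(i)}−x_{σ(j)})` equals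
`4(3a₁⁵ + 12a₁³a₂ + 7a₁a₂² − 5a₁²a₃ − 2a₂a₃ − 10a₁a₄ + 5a₅)`. -/
theorem cobordism_class_M10_J1 {F : Type*} [Field F] [CharZero F]
    (x : Fin 4 → F) (hx : Function.Injective x) (a₁ a₂ a₃ a₄ a₅ : F) (f : F → F[X])
    (hf : ∀ c : F, f c = 1 + C (a₁ * c) * X + C (a₂ * c ^ 2) * X ^ 2 +
      C (a₃ * c ^ 3) * X ^ 3 + C (a₄ * c ^ 4) * X ^ 4 + C (a₅ * c ^ 5) * X ^ 5) :
    (C ((2 : F)⁻¹) *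
        ∑ σ : Equiv.Perm (Fin 4),
          (C ((x (σ 0) - x (σ 2))⁻¹) * f (x (σ 0) - x (σ 2))) *
            (C ((x (σ 0) - x (σ 3))⁻¹) * f (x (σ 0) - x (σ 3))) *
            (C ((x (σ 1) - x (σ 2))⁻¹) * f (x (σ 1) - x (σ 2))) *
            (C ((x (σ 1) - x (σ 3))⁻¹) * f (x (σ 1) - x (σ 3))) *
            (C ((x (σ 2) - x (σ 3))⁻¹) * f (x (σ 2) - x (σ 3)))).coeff 5 =
      4 * (3 * a₁ ^ 5 + 12 * a₁ ^ 3 * a₂ + 7 * a₁ * a₂ ^ 2 - 5 * a₁ ^ 2 * a₃ -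
        2 * a₂ * a₃ - 10 * a₁ * a₄ + 5 * a₅) := by
  set V := vandermondeFour (x 0) (x 1) (x 2) (x 3) with hV
  have hne {i j : Fin 4} (h : i ≠ j) : x i - x j ≠ 0 := sub_ne_zero.mpr (hx.ne h)
  have hV0 : V ≠ 0 := by
    simp [hV, vandermondeFour, hne]
  have hterm (σ : Equiv.Perm (Fin 4)) :
      ((C ((x (σ 0) - x (σ 2))⁻¹) * f (x (σ 0) - x (σ 2))) *
        (C ((x (σ 0) - x (σ 3))⁻¹) * f (x (σ 0) - x (σ 3))) *
        (C ((x (σ 1) - x (σ 2))⁻¹) * f (x (σ 1) - x (σ 2))) *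
        (C ((x (σ 1) - x (σ 3))⁻¹) * f (x (σ 1) - x (σ 3))) *
        (C ((x (σ 2) - x (σ 3))⁻¹) * f (x (σ 2) - x (σ 3)))).coeff 5 =
      V⁻¹ * (((Equiv.Perm.sign σ : ℤ) : F) * ((x (σ 0) - x (σ 1)) *
        (f (x (σ 0) - x (σ 2)) * f (x (σ 0) - x (σ 3)) * f (x (σ 1) - x (σ 2)) *
          f (x (σ 1) - x (σ 3)) * f (x (σ 2) - x (σ 3))).coeff 5)) := by
    have hW := vandermondeFour_comp_perm x σ
    rw [← hV, vandermondeFour] at hW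
    have hd {i j : Fin 4} (h : i ≠ j) : x (σ i) - x (σ j) ≠ 0 := hne (σ.injective.ne h)
    have h01 := hd (show (0 : Fin 4) ≠ 1 by decide)
    have h02 := hd (show (0 : Fin 4) ≠ 2 by decide)
    have h03 := hd (show (0 : Fin 4) ≠ 3 by decide)
    have h12 := hd (show (1 : Fin 4) ≠ 2 by decide)
    have h13 := hd (show (1 : Fin 4) ≠ 3 by decide)
    have h23 := hd (show (2 : Fin 4) ≠ 3 by decide)
    have hsq : ((Equiv.Perm.sign σ : ℤ) : F) * ((Equiv.Perm.sign σ : ℤ) : F) = 1 := by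
      rw [← Int.cast_mul, Int.units_coe_mul_self, Int.cast_one]
    have hinv : (x (σ 0) - x (σ 2))⁻¹ * (x (σ 0) - x (σ 3))⁻¹ * (x (σ 1) - x (σ 2))⁻¹ *
        (x (σ 1) - x (σ 3))⁻¹ * (x (σ 2) - x (σ 3))⁻¹ =
        V⁻¹ * (((Equiv.Perm.sign σ : ℤ) : F) * (x (σ 0) - x (σ 1))) := by
      field_simp
      linear_combination (-((Equiv.Perm.sign σ : ℤ) : F)) * hW - V * hsq
    rw [← mul_assoc (((Equiv.Perm.sign σ : ℤ) : F)), ← mul_assoc V⁻¹, ← hinv, ← coeff_C_mul]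
    congr 1
    simp only [map_mul]
    ring
  rw [coeff_C_mul, finsetSum_coeff, Finset.sum_congr rfl fun σ _ => hterm σ, ← Finset.mul_sum]
  have hsum : ∑ σ : Equiv.Perm (Fin 4), ((Equiv.Perm.sign σ : ℤ) : F) * ((x (σ 0) - x (σ 1)) *
      (f (x (σ 0) - x (σ 2)) * f (x (σ 0) - x (σ 3)) * f (x (σ 1) - x (σ 2)) *
        f (x (σ 1) - x (σ 3)) * f (x (σ 2) - x (σ 3))).coeff 5) =
      a₁ ^ 5 * 24 * V +
        a₁ ^ 3 * a₂ * 96 * V +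
        a₁ * a₂ ^ 2 * 56 * V +
        a₁ ^ 2 * a₃ * (-40) * V +
        a₂ * a₃ * (-16) * V +
        a₁ * a₄ * (-80) * V +
        a₅ * 40 * V := by
    simp only [mul_assoc, hV]
    simp only [← sum_sign_mul_msymmOneOneOneOneOne,
      ← sum_sign_mul_msymmTwoOneOneOne,
      ← sum_sign_mul_msymmTwoTwoOne,
      ← sum_sign_mul_msymmThreeOneOne,
      ← sum_sign_mul_msymmThreeTwo,
      ← sum_sign_mul_msymmFourOne,
      ← sum_sign_mul_msymmFive,
      Finset.mul_sum, ← Finset.sum_add_distrib]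
    refine Finset.sum_congr rfl fun σ _ => ?_
    simp only [← mul_assoc, coeff_five_prod a₁ a₂ a₃ a₄ a₅ f hf]
    ring
  rw [hsum]
  field_simp
  ring
end

section
/- Let F be a field of characteristic zero, let x_1, x_2, x_3, x_4 be pairwise distinct elements of F, let a_1, …, a_5 ∈ F, and set f(s) = 1 + a_1 s + a_2 s² + a_3 s³ + a_4 s⁴ + a_5 s⁵. Let P = {(1,3),(2,3),(4,1),(4,2),(3,4)}. Then the coefficient of t⁵ in the polynomial (1/2) Σ_{σ ∈ S_4} Π_{(i,j) ∈ P} f(t(x_{σ(i)} − x_{σ(j)})) / (x_{σ(i)} − x_{σ(j)}) ∈ F[t] equals 4(3a_1⁵ − 12a_1³a_2 + 7a_1a_2² + 15a_1²a_3 − 12a_2a_3 − 10a_1a_4 + 15a_5). (This computes the cobordism class of M¹⁰ = SU(4)/S(U(1)×U(1)×U(2)) with the non-integrable invariant almost complex structure J_3, whose weights at the identity fixed point are x_1−x_3, x_2−x_3, x_4−x_1, x_4−x_2, x_3−x_4.) -/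
open Polynomial

/-- A sum over the permutations of `Fin 4`, grouped by the transposition of the first two
entries. -/
theorem Equiv.Perm.sum_fin_four {M : Type*} [AddCommMonoid M]
    (g : Fin 4 → Fin 4 → Fin 4 → Fin 4 → M) :
    ∑ σ : Equiv.Perm (Fin 4), g (σ 0) (σ 1) (σ 2) (σ 3) =
      (g 0 1 2 3 + g 1 0 2 3) +
      (g 0 1 3 2 + g 1 0 3 2) +
      (g 0 2 1 3 + g 2 0 1 3) +
      (g 0 2 3 1 + g 2 0 3 1) +
      (g 0 3 1 2 + g 3 0 1 2) +
      (g 0 3 2 1 + g 3 0 2 1) +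
      (g 1 2 0 3 + g 2 1 0 3) +
      (g 1 2 3 0 + g 2 1 3 0) +
      (g 1 3 0 2 + g 3 1 0 2) +
      (g 1 3 2 0 + g 3 1 2 0) +
      (g 2 3 0 1 + g 3 2 0 1) +
      (g 2 3 1 0 + g 3 2 1 0) := by
  rw [← Equiv.sum_comp Equiv.Perm.decomposeFin.symm, Fintype.sum_prod_type]
  simp only [← Equiv.sum_comp (Equiv.Perm.decomposeFin (n := 2)).symm,
    ← Equiv.sum_comp (Equiv.Perm.decomposeFin (n := 1)).symm,
    Fintype.sum_prod_type, Fintype.sum_unique, Fin.sum_univ_succ]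
  have h2 (p : Fin 4) (e : Equiv.Perm (Fin 3)) :
      Equiv.Perm.decomposeFin.symm (p, e) 2 = Equiv.swap 0 p (e 1).succ :=
    Equiv.Perm.decomposeFin_symm_apply_succ e p 1
  have h3 (p : Fin 4) (e : Equiv.Perm (Fin 3)) :
      Equiv.Perm.decomposeFin.symm (p, e) 3 = Equiv.swap 0 p (e 2).succ :=
    Equiv.Perm.decomposeFin_symm_apply_succ e p 2
  have h₂ (p : Fin 3) (e : Equiv.Perm (Fin 2)) :
      Equiv.Perm.decomposeFin.symm (p, e) 2 = Equiv.swap 0 p (e 1).succ :=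
    Equiv.Perm.decomposeFin_symm_apply_succ e p 1
  simp +decide [h2, h3, h₂, Equiv.swap_apply_def]
  abel

/-- The degree five part of `∏ w, (1 + a₁ w + ⋯ + a₅ w ^ 5)` over five variables `w`, written in
terms of the elementary symmetric polynomials `eᵢ` of these variables. -/
def multiplicativeClassFive {R : Type*} [CommRing R] (a₁ a₂ a₃ a₄ a₅ e₁ e₂ e₃ e₄ e₅ : R) : R :=
  a₅ * (e₁ ^ 5 - 5 * e₁ ^ 3 * e₂ + 5 * e₁ * e₂ ^ 2 + 5 * e₁ ^ 2 * e₃ - 5 * e₂ * e₃ -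
      5 * e₁ * e₄ + 5 * e₅) +
    a₄ * a₁ * (e₁ ^ 3 * e₂ - 3 * e₁ * e₂ ^ 2 - e₁ ^ 2 * e₃ + 5 * e₂ * e₃ + e₁ * e₄ - 5 * e₅) +
    a₃ * a₂ * (e₁ * e₂ ^ 2 - 2 * e₁ ^ 2 * e₃ - e₂ * e₃ + 5 * e₁ * e₄ - 5 * e₅) +
    a₃ * a₁ ^ 2 * (e₁ ^ 2 * e₃ - 2 * e₂ * e₃ - e₁ * e₄ + 5 * e₅) +
    a₂ ^ 2 * a₁ * (e₂ * e₃ - 3 * e₁ * e₄ + 5 * e₅) +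
    a₂ * a₁ ^ 3 * (e₁ * e₄ - 5 * e₅) +
    a₁ ^ 5 * e₅

/-- `multiplicativeClassFive` evaluated at the five weights
`a - c`, `b - c`, `d - a`, `d - b`, `c - d`. -/
def weightClass {R : Type*} [CommRing R] (a₁ a₂ a₃ a₄ a₅ a b c d : R) : R :=
  let e₂ := (a - c) * (b - c) + (d - a) * (d - b) + (a - c + (b - c)) * (d - a + (d - b)) +
    (c - d) * (2 * (d - c))
  let e₃ := (a - c) * (b - c) * (d - a + (d - b)) + (d - a) * (d - b) * (a - c + (b - c)) +
    (c - d) * ((a - c) * (b - c) + (d - a) * (d - b) + (a - c + (b - c)) * (d - a + (d - b)))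
  let e₄ := (a - c) * (b - c) * (d - a) * (d - b) +
    (c - d) * ((a - c) * (b - c) * (d - a + (d - b)) + (d - a) * (d - b) * (a - c + (b - c)))
  multiplicativeClassFive a₁ a₂ a₃ a₄ a₅ (d - c) e₂ e₃ e₄
    ((a - c) * (b - c) * (d - a) * (d - b) * (c - d))

/-- `weightClass` is the degree five coefficient of the product of the `f w` over the weights. -/
theorem coeff_five_prod_weights {R : Type*} [CommRing R] (a₁ a₂ a₃ a₄ a₅ : R) (f : R → R[X])
    (hf : ∀ c : R, f c = 1 + C (a₁ * c) * X + C (a₂ * c ^ 2) * X ^ 2 +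
      C (a₃ * c ^ 3) * X ^ 3 + C (a₄ * c ^ 4) * X ^ 4 + C (a₅ * c ^ 5) * X ^ 5) (a b c d : R) :
    (f (a - c) * f (b - c) * f (d - a) * f (d - b) * f (c - d)).coeff 5 =
      weightClass a₁ a₂ a₃ a₄ a₅ a b c d := by
  have hcoeff (w : R) (n : ℕ) : (f w).coeff n = (if n = 0 then 1 else 0) +
      (if n = 1 then a₁ * w else 0) + (if n = 2 then a₂ * w ^ 2 else 0) +
      (if n = 3 then a₃ * w ^ 3 else 0) + (if n = 4 then a₄ * w ^ 4 else 0) +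
      (if n = 5 then a₅ * w ^ 5 else 0) := by
    rw [hf]
    simp only [coeff_add, coeff_one, coeff_C_mul_X, coeff_C_mul_X_pow]
  have h0 (w : R) : (f w).coeff 0 = 1 := by simp [hcoeff]
  have h1 (w : R) : (f w).coeff 1 = a₁ * w := by simp [hcoeff]
  have h2 (w : R) : (f w).coeff 2 = a₂ * w ^ 2 := by simp [hcoeff]
  have h3 (w : R) : (f w).coeff 3 = a₃ * w ^ 3 := by simp [hcoeff]
  have h4 (w : R) : (f w).coeff 4 = a₄ * w ^ 4 := by simp [hcoeff]
  have h5 (w : R) : (f w).coeff 5 = a₅ * w ^ 5 := by simp [hcoeff]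
  simp only [coeff_mul, Finset.Nat.antidiagonal_succ, Finset.Nat.antidiagonal_zero,
    Finset.sum_cons, Finset.map_cons, Finset.map_singleton, Finset.sum_singleton,
    Function.Embedding.prodMap, Function.Embedding.coeFn_mk, Prod.map,
    Nat.succ_eq_add_one, Function.Embedding.refl_apply, zero_add, Nat.reduceAdd,
    h0, h1, h2, h3, h4, h5]
  simp only [weightClass, multiplicativeClassFive]
  ring

/-- The antisymmetrization of `weightClass`, as a multiple of the Vandermonde product. -/
theorem sum_sign_weightClass {R : Type*} [CommRing R] (a₁ a₂ a₃ a₄ a₅ : R) (x : Fin 4 → R) :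
    (x 0 - x 1) * weightClass a₁ a₂ a₃ a₄ a₅ (x 0) (x 1) (x 2) (x 3) -
      (x 0 - x 1) * weightClass a₁ a₂ a₃ a₄ a₅ (x 0) (x 1) (x 3) (x 2) -
      (x 0 - x 2) * weightClass a₁ a₂ a₃ a₄ a₅ (x 0) (x 2) (x 1) (x 3) +
      (x 0 - x 2) * weightClass a₁ a₂ a₃ a₄ a₅ (x 0) (x 2) (x 3) (x 1) +
      (x 0 - x 3) * weightClass a₁ a₂ a₃ a₄ a₅ (x 0) (x 3) (x 1) (x 2) -
      (x 0 - x 3) * weightClass a₁ a₂ a₃ a₄ a₅ (x 0) (x 3) (x 2) (x 1) +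
      (x 1 - x 2) * weightClass a₁ a₂ a₃ a₄ a₅ (x 1) (x 2) (x 0) (x 3) -
      (x 1 - x 2) * weightClass a₁ a₂ a₃ a₄ a₅ (x 1) (x 2) (x 3) (x 0) -
      (x 1 - x 3) * weightClass a₁ a₂ a₃ a₄ a₅ (x 1) (x 3) (x 0) (x 2) +
      (x 1 - x 3) * weightClass a₁ a₂ a₃ a₄ a₅ (x 1) (x 3) (x 2) (x 0) +
      (x 2 - x 3) * weightClass a₁ a₂ a₃ a₄ a₅ (x 2) (x 3) (x 0) (x 1) -
      (x 2 - x 3) * weightClass a₁ a₂ a₃ a₄ a₅ (x 2) (x 3) (x 1) (x 0) =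
      4 * (3 * a₁ ^ 5 - 12 * a₁ ^ 3 * a₂ + 7 * a₁ * a₂ ^ 2 + 15 * a₁ ^ 2 * a₃ -
        12 * a₂ * a₃ - 10 * a₁ * a₄ + 15 * a₅) *
      ((x 0 - x 1) * (x 0 - x 2) * (x 1 - x 2) * (x 3 - x 0) * (x 3 - x 1) * (x 2 - x 3)) := by
  simp only [weightClass, multiplicativeClassFive]
  ring

/-- Cobordism class of `M¹⁰ = SU(4)/S(U(1)×U(1)×U(2))` with the
non-integrable invariant almost complex structure `J₃` (weights
`x₁−x₃, x₂−x₃, x₄−x₁, x₄−x₂, x₃−x₄`): the coefficient of `t⁵` in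
`(1/2) Σ_{σ ∈ S₄} Π_{(i,j)∈P} f(t(x_{σ(i)}−x_{σ(j)}))/(x_{σ(i)}−x_{σ(j)})` equals
`4(3a₁⁵ − 12a₁³a₂ + 7a₁a₂² + 15a₁²a₃ − 12a₂a₃ − 10a₁a₄ + 15a₅)`. -/
theorem cobordism_class_M10_J3 {F : Type*} [Field F] [CharZero F]
    (x : Fin 4 → F) (hx : Function.Injective x) (a₁ a₂ a₃ a₄ a₅ : F) (f : F → F[X])
    (hf : ∀ c : F, f c = 1 + C (a₁ * c) * X + C (a₂ * c ^ 2) * X ^ 2 +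
      C (a₃ * c ^ 3) * X ^ 3 + C (a₄ * c ^ 4) * X ^ 4 + C (a₅ * c ^ 5) * X ^ 5) :
    (C ((2 : F)⁻¹) *
        ∑ σ : Equiv.Perm (Fin 4),
          (C ((x (σ 0) - x (σ 2))⁻¹) * f (x (σ 0) - x (σ 2))) *
            (C ((x (σ 1) - x (σ 2))⁻¹) * f (x (σ 1) - x (σ 2))) *
            (C ((x (σ 3) - x (σ 0))⁻¹) * f (x (σ 3) - x (σ 0))) *
            (C ((x (σ 3) - x (σ 1))⁻¹) * f (x (σ 3) - x (σ 1))) *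
            (C ((x (σ 2) - x (σ 3))⁻¹) * f (x (σ 2) - x (σ 3)))).coeff 5 =
      4 * (3 * a₁ ^ 5 - 12 * a₁ ^ 3 * a₂ + 7 * a₁ * a₂ ^ 2 + 15 * a₁ ^ 2 * a₃ -
        12 * a₂ * a₃ - 10 * a₁ * a₄ + 15 * a₅) := by
  have hne {i j : Fin 4} (h : i ≠ j) : x i - x j ≠ 0 := sub_ne_zero.2 (hx.ne h)
  set V := (x 0 - x 1) * (x 0 - x 2) * (x 1 - x 2) * (x 3 - x 0) * (x 3 - x 1) * (x 2 - x 3) with hV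
  have hV0 : V ≠ 0 := by
    simp only [hV]
    refine mul_ne_zero (mul_ne_zero (mul_ne_zero (mul_ne_zero (mul_ne_zero ?_ ?_) ?_) ?_) ?_) ?_ <;>
      exact hne (by decide)
  let T (i j k l : Fin 4) : F[X] :=
    (C ((x i - x k)⁻¹) * f (x i - x k)) * (C ((x j - x k)⁻¹) * f (x j - x k)) *
      (C ((x l - x i)⁻¹) * f (x l - x i)) * (C ((x l - x j)⁻¹) * f (x l - x j)) *
      (C ((x k - x l)⁻¹) * f (x k - x l))
  have hterm (i j k l : Fin 4) (s : F) (hs : s * s = 1)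
      (hVs : (x i - x j) * (x i - x k) * (x j - x k) * (x l - x i) * (x l - x j) * (x k - x l) =
        s * V) :
      (T i j k l).coeff 5 + (T j i k l).coeff 5 =
        2 * (s * (x i - x j) * weightClass a₁ a₂ a₃ a₄ a₅ (x i) (x j) (x k) (x l)) / V := by
    have hs0 : s ≠ 0 := left_ne_zero_of_mul_eq_one hs
    have hprod := mul_ne_zero hs0 hV0
    rw [← hVs] at hprod
    simp only [mul_ne_zero_iff] at hprod
    obtain ⟨⟨⟨⟨⟨h₁, h₂⟩, h₃⟩, h₄⟩, h₅⟩, h₆⟩ := hprod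
    have hT : T i j k l + T j i k l =
        C (2 * ((x i - x k) * (x j - x k) * (x l - x i) * (x l - x j) * (x k - x l))⁻¹) *
          (f (x i - x k) * f (x j - x k) * f (x l - x i) * f (x l - x j) * f (x k - x l)) := by
      simp only [T, mul_inv, C_mul, C_ofNat]
      ring
    rw [← coeff_add, hT, coeff_C_mul, coeff_five_prod_weights a₁ a₂ a₃ a₄ a₅ f hf]
    have hVe : V = s * ((x i - x j) * (x i - x k) * (x j - x k) * (x l - x i) * (x l - x j) *
        (x k - x l)) := by
      rw [hVs, ← mul_assoc, hs, one_mul]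
    rw [hVe]
    field_simp
  rw [show (∑ σ : Equiv.Perm (Fin 4), _) = _ from Equiv.Perm.sum_fin_four T]
  have hsum := sum_sign_weightClass a₁ a₂ a₃ a₄ a₅ x
  rw [← hV, ← div_eq_iff hV0] at hsum
  rw [coeff_C_mul, inv_mul_eq_iff_eq_mul₀ two_ne_zero, ← hsum]
  simp only [coeff_add]
  rw [hterm 0 1 2 3 1 (by norm_num) (by rw [hV]; ring),
    hterm 0 1 3 2 (-1) (by norm_num) (by rw [hV]; ring),
    hterm 0 2 1 3 (-1) (by norm_num) (by rw [hV]; ring),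
    hterm 0 2 3 1 1 (by norm_num) (by rw [hV]; ring),
    hterm 0 3 1 2 1 (by norm_num) (by rw [hV]; ring),
    hterm 0 3 2 1 (-1) (by norm_num) (by rw [hV]; ring),
    hterm 1 2 0 3 1 (by norm_num) (by rw [hV]; ring),
    hterm 1 2 3 0 (-1) (by norm_num) (by rw [hV]; ring),
    hterm 1 3 0 2 (-1) (by norm_num) (by rw [hV]; ring),
    hterm 1 3 2 0 1 (by norm_num) (by rw [hV]; ring),
    hterm 2 3 0 1 1 (by norm_num) (by rw [hV]; ring),
    hterm 2 3 1 0 (-1) (by norm_num) (by rw [hV]; ring)]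
  ring
end
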